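/- Let u : ℝⁿ × [0,T] → ℝ be a smooth solution of the biharmonic heat equation ∂ₜu = -Δ²u and let k ∈ ℕ with k ≥ 1. Let s > 4k, ρ > 0, and let γ ∈ C^∞(ℝⁿ) satisfy χ_{B_ρ(0)} ≤ γ ≤ χ_{B_{2ρ}(0)}, |∇γ| ≤ c_γ/ρ and |∇²γ| ≤ c_γ/ρ², where c_γ ≥ 1 is a constant depending only on n; set η = γˢ. Then there is a constant c₄ = c₄(n,s) such that (d/dt) E^k_η(u) + E^{k+1}_η(u) ≤ (c₄/ρ^{4k}) ∫_{ℝⁿ} |Δu|² γ^{s-4k} dx for all t ∈ [0,T]. -/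

import Mathlib

open MeasureTheory Metric Set

noncomputable section

/-- The spatial Laplacian of a function `f : ℝⁿ → ℝ`: `Δf(x) = ∑ i, ∂²f/∂xᵢ²(x)`. -/
def Lap {n : ℕ} (f : EuclideanSpace ℝ (Fin n) → ℝ) : EuclideanSpace ℝ (Fin n) → ℝ :=
  fun x => ∑ i : Fin n,
    iteratedFDeriv ℝ 2 f x (fun _ => EuclideanSpace.single i (1 : ℝ))

/-- The `k`-th iterated Laplacian (`iterLap 0 f = f`, `iterLap 2 f = Δ²f`). -/
def iterLap {n : ℕ} (k : ℕ) (f : EuclideanSpace ℝ (Fin n) → ℝ) :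
    EuclideanSpace ℝ (Fin n) → ℝ :=
  Lap^[k] f

/-- Partial derivative of `f` in the `i`-th coordinate direction. -/
def pderiv1 {n : ℕ} (i : Fin n) (f : EuclideanSpace ℝ (Fin n) → ℝ)
    (x : EuclideanSpace ℝ (Fin n)) : ℝ :=
  fderiv ℝ f x (EuclideanSpace.single i (1 : ℝ))

/-- A smooth cutoff function `γ` as in `(γ)`: `χ_{B_ρ(0)} ≤ γ ≤ χ_{B_{2ρ}(0)}`,
`|∇γ| ≤ c_γ/ρ` and `|∇²γ| ≤ c_γ/ρ²`. -/
structure IsCutoff {n : ℕ} (γ : EuclideanSpace ℝ (Fin n) → ℝ) (ρ cγ : ℝ) : Prop where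
  smooth : ContDiff ℝ (⊤ : ℕ∞) γ
  lower : ∀ x, Set.indicator (Metric.ball (0 : EuclideanSpace ℝ (Fin n)) ρ) 1 x ≤ γ x
  upper : ∀ x, γ x ≤ Set.indicator (Metric.ball (0 : EuclideanSpace ℝ (Fin n)) (2 * ρ)) 1 x
  grad : ∀ x, ‖fderiv ℝ γ x‖ ≤ cγ / ρ
  hess : ∀ x, ‖iteratedFDeriv ℝ 2 γ x‖ ≤ cγ / ρ ^ 2

section Coordinates

variable {n : ℕ} {f g : EuclideanSpace ℝ (Fin n) → ℝ}

lemma contDiff_pderiv1 (hf : ContDiff ℝ (⊤ : ℕ∞) f) (i : Fin n) :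
    ContDiff ℝ (⊤ : ℕ∞) (pderiv1 i f) :=
  (hf.fderiv_right (m := (⊤ : ℕ∞)) (by simp)).clm_apply contDiff_const

lemma Lap_eq_sum_pderiv1 (hf : ContDiff ℝ (⊤ : ℕ∞) f) :
    Lap f = fun x => ∑ i : Fin n, pderiv1 i (pderiv1 i f) x := by
  funext x
  refine Finset.sum_congr rfl fun i _ => ?_
  have hd : DifferentiableAt ℝ (fderiv ℝ f) x :=
    (hf.fderiv_right (m := (⊤ : ℕ∞)) (by simp)).differentiable (by simp) x
  rw [iteratedFDeriv_two_apply]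
  change _ = fderiv ℝ (fun y => fderiv ℝ f y (EuclideanSpace.single i (1 : ℝ))) x _
  rw [fderiv_clm_apply hd (differentiableAt_const _)]
  simp

lemma contDiff_Lap (hf : ContDiff ℝ (⊤ : ℕ∞) f) : ContDiff ℝ (⊤ : ℕ∞) (Lap f) := by
  rw [Lap_eq_sum_pderiv1 hf]
  exact ContDiff.sum fun i _ => contDiff_pderiv1 (contDiff_pderiv1 hf i) i

lemma contDiff_iterLap (hf : ContDiff ℝ (⊤ : ℕ∞) f) (k : ℕ) :
    ContDiff ℝ (⊤ : ℕ∞) (iterLap k f) := by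
  induction k with
  | zero => exact hf
  | succ k ih => rw [iterLap, Function.iterate_succ_apply']; exact contDiff_Lap ih

lemma pderiv1_mul (hf : ContDiff ℝ (⊤ : ℕ∞) f) (hg : ContDiff ℝ (⊤ : ℕ∞) g) (i : Fin n)
    (x : EuclideanSpace ℝ (Fin n)) :
    pderiv1 i (fun y => f y * g y) x = f x * pderiv1 i g x + g x * pderiv1 i f x := by
  rw [pderiv1, fderiv_fun_mul (hf.differentiable (by simp) x) (hg.differentiable (by simp) x)]
  simp [pderiv1]

lemma pderiv1_sub (hf : ContDiff ℝ (⊤ : ℕ∞) f) (hg : ContDiff ℝ (⊤ : ℕ∞) g) (i : Fin n)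
    (x : EuclideanSpace ℝ (Fin n)) :
    pderiv1 i (fun y => f y - g y) x = pderiv1 i f x - pderiv1 i g x := by
  rw [pderiv1, fderiv_fun_sub (hf.differentiable (by simp) x) (hg.differentiable (by simp) x)]
  simp [pderiv1]

end Coordinates

namespace IsCutoff

variable {n : ℕ} {γ : EuclideanSpace ℝ (Fin n) → ℝ} {ρ c : ℝ}

lemma nonneg (hγ : IsCutoff γ ρ c) (x : EuclideanSpace ℝ (Fin n)) : 0 ≤ γ x :=
  (Set.indicator_nonneg (fun _ _ => zero_le_one) x).trans (hγ.lower x)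

lemma le_one (hγ : IsCutoff γ ρ c) (x : EuclideanSpace ℝ (Fin n)) : γ x ≤ 1 :=
  (hγ.upper x).trans (Set.indicator_le_self' (fun _ _ => zero_le_one) x)

lemma eq_zero (hγ : IsCutoff γ ρ c) {x : EuclideanSpace ℝ (Fin n)}
    (hx : x ∉ ball (0 : EuclideanSpace ℝ (Fin n)) (2 * ρ)) : γ x = 0 :=
  le_antisymm (by simpa [hx] using hγ.upper x) (hγ.nonneg x)

lemma abs_pderiv1_le (hγ : IsCutoff γ ρ c) (i : Fin n) (x : EuclideanSpace ℝ (Fin n)) :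
    |pderiv1 i γ x| ≤ c * ρ⁻¹ := by
  have h := (fderiv ℝ γ x).le_opNorm (EuclideanSpace.single i (1 : ℝ))
  rw [PiLp.norm_single, norm_one, mul_one] at h
  exact h.trans (hγ.grad x)

lemma abs_pderiv1_pderiv1_le (hγ : IsCutoff γ ρ c) (i : Fin n) (x : EuclideanSpace ℝ (Fin n)) :
    |pderiv1 i (pderiv1 i γ) x| ≤ c * ρ⁻¹ ^ 2 := by
  have hd : DifferentiableAt ℝ (fderiv ℝ γ) x :=
    (hγ.smooth.fderiv_right (m := (⊤ : ℕ∞)) (by simp)).differentiable (by simp) x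
  have h := (iteratedFDeriv ℝ 2 γ x).le_opNorm (fun _ => EuclideanSpace.single i (1 : ℝ))
  rw [iteratedFDeriv_two_apply] at h
  have h2 : pderiv1 i (pderiv1 i γ) x = fderiv ℝ (fderiv ℝ γ) x
      (EuclideanSpace.single i (1 : ℝ)) (EuclideanSpace.single i (1 : ℝ)) := by
    change fderiv ℝ (fun y => fderiv ℝ γ y (EuclideanSpace.single i (1 : ℝ))) x _ = _
    rw [fderiv_clm_apply hd (differentiableAt_const _)]
    simp
  simp only [PiLp.norm_single, norm_one, Finset.prod_const_one, mul_one] at h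
  rw [h2, inv_pow]
  exact h.trans (hγ.hess x)

lemma continuous_rpow (hγ : IsCutoff γ ρ c) {q : ℝ} (hq : 0 < q) :
    Continuous fun x => γ x ^ q :=
  hγ.smooth.continuous.rpow_const fun _ => Or.inr hq.le

lemma integrable_mul_rpow (hγ : IsCutoff γ ρ c) {q : ℝ} (hq : 0 < q)
    {F : EuclideanSpace ℝ (Fin n) → ℝ} (hF : Continuous F) :
    Integrable fun x => F x * γ x ^ q := by
  refine (hF.mul (hγ.continuous_rpow hq)).integrable_of_hasCompactSupport ?_
  refine HasCompactSupport.intro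
    (isCompact_closedBall (0 : EuclideanSpace ℝ (Fin n)) (2 * ρ)) fun x hx => ?_
  simp [hγ.eq_zero fun h => hx (ball_subset_closedBall h), Real.zero_rpow hq.ne']

lemma rpow_add_natCast (hγ : IsCutoff γ ρ c) {q : ℝ} (hq : 0 < q) (m : ℕ)
    (x : EuclideanSpace ℝ (Fin n)) : γ x ^ (q + m) = γ x ^ m * γ x ^ q := by
  rw [Real.rpow_add' (hγ.nonneg x) (by positivity), Real.rpow_natCast, mul_comm]

end IsCutoff

/-- The integral of `F` against the weight `γ ^ q`. -/
def weightedIntegral {n : ℕ} (γ : EuclideanSpace ℝ (Fin n) → ℝ) (q : ℝ)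
    (F : EuclideanSpace ℝ (Fin n) → ℝ) : ℝ :=
  ∫ x, F x * γ x ^ q

section Weighted

variable {n : ℕ} {γ : EuclideanSpace ℝ (Fin n) → ℝ} {ρ c : ℝ}

lemma weightedIntegral_add_natCast (hγ : IsCutoff γ ρ c) {q : ℝ} (hq : 0 < q) (m : ℕ)
    (F : EuclideanSpace ℝ (Fin n) → ℝ) :
    weightedIntegral γ (q + m) F = weightedIntegral γ q fun x => F x * γ x ^ m := by
  simp only [weightedIntegral, hγ.rpow_add_natCast hq, mul_assoc]

lemma weightedIntegral_nonneg (hγ : IsCutoff γ ρ c) (q : ℝ)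
    {F : EuclideanSpace ℝ (Fin n) → ℝ} (hF : ∀ x, 0 ≤ F x) : 0 ≤ weightedIntegral γ q F :=
  integral_nonneg fun x => mul_nonneg (hF x) (Real.rpow_nonneg (hγ.nonneg x) q)

lemma weightedIntegral_sum (hγ : IsCutoff γ ρ c) {q : ℝ} (hq : 0 < q)
    {F : Fin n → EuclideanSpace ℝ (Fin n) → ℝ} (hF : ∀ i, Continuous (F i)) :
    weightedIntegral γ q (fun x => ∑ i, F i x) = ∑ i, weightedIntegral γ q (F i) := by
  simp only [weightedIntegral, Finset.sum_mul]
  exact integral_finsetSum _ fun i _ => hγ.integrable_mul_rpow hq (hF i)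

lemma weightedIntegral_sub (hγ : IsCutoff γ ρ c) {q : ℝ} (hq : 0 < q)
    {F G : EuclideanSpace ℝ (Fin n) → ℝ} (hF : Continuous F) (hG : Continuous G) :
    weightedIntegral γ q (fun x => F x - G x)
      = weightedIntegral γ q F - weightedIntegral γ q G := by
  simp only [weightedIntegral, sub_mul]
  exact integral_sub (hγ.integrable_mul_rpow hq hF) (hγ.integrable_mul_rpow hq hG)

lemma weightedIntegral_const_mul (q a : ℝ) (F : EuclideanSpace ℝ (Fin n) → ℝ) :
    weightedIntegral γ q (fun x => a * F x) = a * weightedIntegral γ q F := by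
  simp only [weightedIntegral, mul_assoc]
  exact integral_const_mul _ _

lemma weightedIntegral_le_of_le (hγ : IsCutoff γ ρ c) {q : ℝ} (hq : 0 < q)
    {F D G H K : EuclideanSpace ℝ (Fin n) → ℝ} (hF : Continuous F) (hD : Continuous D)
    (hG : Continuous G) (hH : Continuous H) (hK : Continuous K)
    (hD0 : weightedIntegral γ q D = 0) (d a b e : ℝ)
    (h : ∀ x, F x ≤ d * D x + a * G x + b * H x + e * K x) :
    weightedIntegral γ q F
      ≤ a * weightedIntegral γ q G + b * weightedIntegral γ q H + e * weightedIntegral γ q K := by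
  have iD := (hγ.integrable_mul_rpow hq hD).const_mul d
  have iG := (hγ.integrable_mul_rpow hq hG).const_mul a
  have iH := (hγ.integrable_mul_rpow hq hH).const_mul b
  have iK := (hγ.integrable_mul_rpow hq hK).const_mul e
  have iDG : Integrable fun x => d * (D x * γ x ^ q) + a * (G x * γ x ^ q) := iD.add iG
  have iDGH : Integrable fun x => d * (D x * γ x ^ q) + a * (G x * γ x ^ q)
      + b * (H x * γ x ^ q) := iDG.add iH
  have key : weightedIntegral γ q F ≤ ∫ x, (d * (D x * γ x ^ q) + a * (G x * γ x ^ q)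
      + b * (H x * γ x ^ q) + e * (K x * γ x ^ q)) := by
    refine integral_mono (hγ.integrable_mul_rpow hq hF) (iDGH.add iK) fun x => ?_
    have := mul_le_mul_of_nonneg_right (h x) (Real.rpow_nonneg (hγ.nonneg x) q)
    simp only
    linarith
  rw [integral_add iDGH iK, integral_add iDG iH, integral_add iD iG,
    integral_const_mul, integral_const_mul, integral_const_mul, integral_const_mul] at key
  simp only [weightedIntegral] at hD0 key ⊢
  rw [hD0] at key
  linarith

/-- Integration by parts against the weight `γ ^ (q + 1)`. -/
lemma weightedIntegral_pderiv1_eq_zero (hγ : IsCutoff γ ρ c) {q : ℝ} (hq : 0 < q)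
    {f : EuclideanSpace ℝ (Fin n) → ℝ} (hf : ContDiff ℝ (⊤ : ℕ∞) f) (i : Fin n) :
    weightedIntegral γ q
      (fun x => pderiv1 i f x * γ x + (q + 1) * (f x * pderiv1 i γ x)) = 0 := by
  have hq1 : 0 < q + 1 := by linarith
  have hφ (x) : HasFDerivAt (fun y => γ y ^ (q + 1))
      (((q + 1) * γ x ^ q) • fderiv ℝ γ x) x := by
    have := (hγ.smooth.differentiable (by simp) x).hasFDerivAt.rpow_const (p := q + 1)
      (Or.inr (by linarith))
    rwa [add_sub_cancel_right] at this
  have h1 : Integrable fun x => pderiv1 i f x * γ x ^ (q + 1) :=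
    hγ.integrable_mul_rpow hq1 (contDiff_pderiv1 hf i).continuous
  have cf := hf.continuous
  have cγ := (contDiff_pderiv1 hγ.smooth i).continuous
  have h2 : Integrable fun x => ((q + 1) * (f x * pderiv1 i γ x)) * γ x ^ q :=
    hγ.integrable_mul_rpow hq (by fun_prop)
  have e2 (x) : fderiv ℝ (fun y => γ y ^ (q + 1)) x (EuclideanSpace.single i (1 : ℝ)) * f x
      = ((q + 1) * (f x * pderiv1 i γ x)) * γ x ^ q := by
    rw [(hφ x).fderiv]
    simp only [smul_apply, smul_eq_mul, pderiv1]
    ring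
  have e1 (x) : γ x ^ (q + 1) * fderiv ℝ f x (EuclideanSpace.single i (1 : ℝ))
      = pderiv1 i f x * γ x ^ (q + 1) := mul_comm _ _
  have key := integral_mul_fderiv_eq_neg_fderiv_mul_of_integrable
    (μ := (volume : Measure (EuclideanSpace ℝ (Fin n))))
    (f := fun y => γ y ^ (q + 1)) (g := f) (v := EuclideanSpace.single i (1 : ℝ))
    (by simpa only [e2] using h2) (by simpa only [e1] using h1)
    (by simpa only [mul_comm] using hγ.integrable_mul_rpow hq1 cf)
    (fun x _ => (hφ x).differentiableAt) (fun x _ => hf.differentiable (by simp) x)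
  simp only [e1, e2] at key
  have e3 (x) : (pderiv1 i f x * γ x + (q + 1) * (f x * pderiv1 i γ x)) * γ x ^ q
      = pderiv1 i f x * γ x ^ (q + 1) + ((q + 1) * (f x * pderiv1 i γ x)) * γ x ^ q := by
    have := hγ.rpow_add_natCast hq 1 x
    rw [Nat.cast_one, pow_one] at this
    rw [this]
    ring
  simp only [weightedIntegral, e3]
  rw [integral_add h1 h2, key, neg_add_cancel]

end Weighted

section Interpolation

variable {n : ℕ} {γ : EuclideanSpace ℝ (Fin n) → ℝ} {ρ c : ℝ}
  {v : EuclideanSpace ℝ (Fin n) → ℝ}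

lemma weightedIntegral_pderiv1_sq_le (hγ : IsCutoff γ ρ c) {q : ℝ} (hq : 0 < q)
    (hv : ContDiff ℝ (⊤ : ℕ∞) v) (i : Fin n) :
    weightedIntegral γ q (fun x => pderiv1 i v x ^ 2 * γ x ^ 2)
      ≤ -2 * weightedIntegral γ q (fun x => v x * pderiv1 i (pderiv1 i v) x * γ x ^ 2)
        + (q + 2) ^ 2 * (c * ρ⁻¹) ^ 2 * weightedIntegral γ q (fun x => v x ^ 2) := by
  have hγs := hγ.smooth
  have hv1 := contDiff_pderiv1 hv i
  have hD := weightedIntegral_pderiv1_eq_zero hγ hq ((hv.mul hv1).mul hγs) i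
  have e (x) : pderiv1 i (fun y => v y * pderiv1 i v y * γ y) x * γ x
      + (q + 1) * (v x * pderiv1 i v x * γ x * pderiv1 i γ x)
      = (pderiv1 i v x ^ 2 + v x * pderiv1 i (pderiv1 i v) x) * γ x ^ 2
        + (q + 2) * (v x * pderiv1 i v x * γ x * pderiv1 i γ x) := by
    rw [pderiv1_mul (hv.mul hv1) hγs, pderiv1_mul hv hv1]
    ring
  simp only [e] at hD
  have c0 := hv.continuous
  have c1 := hv1.continuous
  have c2 := (contDiff_pderiv1 hv1 i).continuous
  have cg := hγs.continuous
  have cg1 := (contDiff_pderiv1 hγs i).continuous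
  have h := weightedIntegral_le_of_le hγ hq
    (F := fun x => pderiv1 i v x ^ 2 * γ x ^ 2)
    (G := fun x => v x * pderiv1 i (pderiv1 i v) x * γ x ^ 2)
    (H := fun x => v x ^ 2) (K := fun _ => 0)
    (by fun_prop) (by fun_prop) (by fun_prop) (by fun_prop) (by fun_prop) hD
    2 (-2) ((q + 2) ^ 2 * (c * ρ⁻¹) ^ 2) 0 ?_
  · linarith
  · intro x
    have hb : pderiv1 i γ x ^ 2 ≤ (c * ρ⁻¹) ^ 2 :=
      sq_le_sq' (abs_le.1 (hγ.abs_pderiv1_le i x)).1 (abs_le.1 (hγ.abs_pderiv1_le i x)).2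
    have h1 := mul_le_mul_of_nonneg_left hb (sq_nonneg ((q + 2) * v x))
    nlinarith [sq_nonneg (pderiv1 i v x * γ x + (q + 2) * v x * pderiv1 i γ x)]

lemma weightedIntegral_gradient_sq_le (hγ : IsCutoff γ ρ c) {q : ℝ} (hq : 0 < q)
    (hv : ContDiff ℝ (⊤ : ℕ∞) v) {l : ℝ} (hl : 0 < l) :
    ∑ i, weightedIntegral γ q (fun x => pderiv1 i v x ^ 2 * γ x ^ 2)
      ≤ l * weightedIntegral γ q (fun x => Lap v x ^ 2 * γ x ^ 4)
        + (l⁻¹ + n * ((q + 2) ^ 2 * (c * ρ⁻¹) ^ 2)) * weightedIntegral γ q (fun x => v x ^ 2) := by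
  have c0 := hv.continuous
  have cL := (contDiff_Lap hv).continuous
  have cg := hγ.smooth.continuous
  have c2 (i) := (contDiff_pderiv1 (contDiff_pderiv1 hv i) i).continuous
  have h := Finset.sum_le_sum fun i (_ : i ∈ Finset.univ) =>
    weightedIntegral_pderiv1_sq_le hγ hq hv i
  rw [Finset.sum_add_distrib, ← Finset.mul_sum, ← weightedIntegral_sum hγ hq
      (F := fun i x => v x * pderiv1 i (pderiv1 i v) x * γ x ^ 2) (fun i => by fun_prop),
    Finset.sum_const, Finset.card_univ, Fintype.card_fin, nsmul_eq_mul] at h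
  have e : (fun x => ∑ i, v x * pderiv1 i (pderiv1 i v) x * γ x ^ 2)
      = fun x => v x * Lap v x * γ x ^ 2 := by
    funext x
    rw [Lap_eq_sum_pderiv1 hv, Finset.mul_sum, Finset.sum_mul]
  rw [e, ← weightedIntegral_const_mul] at h
  have h2 := weightedIntegral_le_of_le hγ hq
    (F := fun x => -2 * (v x * Lap v x * γ x ^ 2)) (D := fun _ => 0)
    (G := fun x => Lap v x ^ 2 * γ x ^ 4)
    (H := fun x => v x ^ 2) (K := fun _ => 0)
    (by fun_prop) (by fun_prop) (by fun_prop) (by fun_prop) (by fun_prop)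
    (by simp [weightedIntegral]) 0 l l⁻¹ 0 ?_
  · linarith
  · intro x
    have : l * (Lap v x ^ 2 * γ x ^ 4) + l⁻¹ * v x ^ 2 + 2 * (v x * Lap v x * γ x ^ 2)
        = l⁻¹ * (l * (Lap v x * γ x ^ 2) + v x) ^ 2 := by
      field_simp
      ring
    have h3 : 0 ≤ l⁻¹ * (l * (Lap v x * γ x ^ 2) + v x) ^ 2 := by positivity
    linarith

lemma weightedIntegral_green_coordinate_le (hγ : IsCutoff γ ρ c) {q : ℝ}
    (hq : 0 < q) (hv : ContDiff ℝ (⊤ : ℕ∞) v) {w : EuclideanSpace ℝ (Fin n) → ℝ}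
    (hw : ContDiff ℝ (⊤ : ℕ∞) w) {δ : ℝ} (hδ : 0 < δ) (i : Fin n) :
    weightedIntegral γ q (fun x => (w x * pderiv1 i (pderiv1 i v) x
        - v x * pderiv1 i (pderiv1 i w) x) * γ x ^ 4)
      ≤ δ * weightedIntegral γ q (fun x => w x ^ 2 * γ x ^ 4)
        + 2 * (q + 4) ^ 2 * (c * ρ⁻¹) ^ 2 / δ
            * weightedIntegral γ q (fun x => pderiv1 i v x ^ 2 * γ x ^ 2)
        + ((q + 4) * c + (q + 4) * (q + 3) * c ^ 2) ^ 2 * ρ⁻¹ ^ 4 / (2 * δ)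
            * weightedIntegral γ q (fun x => v x ^ 2) := by
  have hγs := hγ.smooth
  have hγ1 := contDiff_pderiv1 hγs i
  have hv1 := contDiff_pderiv1 hv i
  have hw1 := contDiff_pderiv1 hw i
  have hf := (((hv.mul hw1).sub (hw.mul hv1)).mul (hγs.pow 3))
  have hg := ((hv.mul hw).mul hγ1).mul (hγs.pow 2)
  have c0 := hv.continuous
  have c1 := hv1.continuous
  have c2 := (contDiff_pderiv1 hv1 i).continuous
  have d0 := hw.continuous
  have d1 := hw1.continuous
  have d2 := (contDiff_pderiv1 hw1 i).continuous
  have cg := hγs.continuous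
  have cg1 := hγ1.continuous
  have cg2 := (contDiff_pderiv1 hγ1 i).continuous
  have hD1 := weightedIntegral_pderiv1_eq_zero hγ hq hf i
  have hD2 := weightedIntegral_pderiv1_eq_zero hγ hq hg i
  have p2 (x) : pderiv1 i (fun y => γ y ^ 2) x = 2 * γ x * pderiv1 i γ x := by
    simp only [sq]
    rw [pderiv1_mul hγs hγs]
    ring
  have p3 (x) : pderiv1 i (fun y => γ y ^ 3) x = 3 * γ x ^ 2 * pderiv1 i γ x := by
    simp only [pow_succ _ 2]
    rw [pderiv1_mul (hγs.pow 2) hγs, p2]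
    ring
  have e1 (x) : pderiv1 i (fun y => (v y * pderiv1 i w y - w y * pderiv1 i v y) * γ y ^ 3) x * γ x
      + (q + 1) * ((v x * pderiv1 i w x - w x * pderiv1 i v x) * γ x ^ 3 * pderiv1 i γ x)
      = (v x * pderiv1 i (pderiv1 i w) x - w x * pderiv1 i (pderiv1 i v) x) * γ x ^ 4
        + (q + 4) * ((v x * pderiv1 i w x - w x * pderiv1 i v x) * γ x ^ 3 * pderiv1 i γ x) := by
    rw [pderiv1_mul ((hv.mul hw1).sub (hw.mul hv1)) (hγs.pow 3), p3,
      pderiv1_sub (hv.mul hw1) (hw.mul hv1), pderiv1_mul hv hw1, pderiv1_mul hw hv1]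
    ring
  have e2 (x) : pderiv1 i (fun y => v y * w y * pderiv1 i γ y * γ y ^ 2) x * γ x
      + (q + 1) * (v x * w x * pderiv1 i γ x * γ x ^ 2 * pderiv1 i γ x)
      = (pderiv1 i v x * w x * pderiv1 i γ x + v x * pderiv1 i w x * pderiv1 i γ x
          + v x * w x * pderiv1 i (pderiv1 i γ) x) * γ x ^ 3
        + (q + 3) * (v x * w x * pderiv1 i γ x ^ 2 * γ x ^ 2) := by
    rw [pderiv1_mul ((hv.mul hw).mul hγ1) (hγs.pow 2), p2, pderiv1_mul (hv.mul hw) hγ1,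
      pderiv1_mul hv hw]
    ring
  simp only [e1] at hD1
  simp only [e2] at hD2
  have hD : weightedIntegral γ q (fun x => (v x * pderiv1 i (pderiv1 i w) x
      - w x * pderiv1 i (pderiv1 i v) x) * γ x ^ 4
        + (q + 4) * ((v x * pderiv1 i w x - w x * pderiv1 i v x) * γ x ^ 3 * pderiv1 i γ x)
      - (q + 4) * ((pderiv1 i v x * w x * pderiv1 i γ x + v x * pderiv1 i w x * pderiv1 i γ x
          + v x * w x * pderiv1 i (pderiv1 i γ) x) * γ x ^ 3
        + (q + 3) * (v x * w x * pderiv1 i γ x ^ 2 * γ x ^ 2))) = 0 := by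
    rw [weightedIntegral_sub hγ hq (by fun_prop) (by fun_prop), weightedIntegral_const_mul, hD1,
      hD2]
    simp
  refine weightedIntegral_le_of_le hγ hq (by fun_prop) (by fun_prop) (by fun_prop) (by fun_prop)
    (by fun_prop) hD (-1) _ _ _ fun x => ?_
  have hr : |pderiv1 i γ x| ≤ c * ρ⁻¹ := hγ.abs_pderiv1_le i x
  have hs := hγ.abs_pderiv1_pderiv1_le i x
  have g0 := hγ.nonneg x
  have g1 := hγ.le_one x
  set a := pderiv1 i γ x
  set b := pderiv1 i (pderiv1 i γ) x
  set g := γ x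
  set r := ρ⁻¹
  have hb2 : a ^ 2 ≤ (c * r) ^ 2 := sq_le_sq' (abs_le.1 hr).1 (abs_le.1 hr).2
  have hN : |(q + 4) * b * g + (q + 4) * (q + 3) * a ^ 2|
      ≤ ((q + 4) * c + (q + 4) * (q + 3) * c ^ 2) * r ^ 2 := by
    refine (abs_add_le _ _).trans ?_
    rw [abs_mul, abs_mul, abs_mul, abs_of_pos (by positivity : 0 < q + 4), abs_of_nonneg g0,
      abs_of_nonneg (by positivity : 0 ≤ (q + 4) * (q + 3)), abs_of_nonneg (sq_nonneg a)]
    have h1 : |b| * g ≤ c * r ^ 2 :=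
      (mul_le_of_le_one_right (abs_nonneg b) g1).trans hs
    have h2 := mul_le_mul_of_nonneg_left h1 (by positivity : 0 ≤ q + 4)
    have h3 := mul_le_mul_of_nonneg_left hb2 (by positivity : 0 ≤ (q + 4) * (q + 3))
    linarith
  have hN2 : ((q + 4) * b * g + (q + 4) * (q + 3) * a ^ 2) ^ 2
      ≤ ((q + 4) * c + (q + 4) * (q + 3) * c ^ 2) ^ 2 * r ^ 4 := by
    have := sq_le_sq' (abs_le.1 hN).1 (abs_le.1 hN).2
    linarith
  have y1 : -(2 * ((q + 4) * a * pderiv1 i v x * g) * (w x * g ^ 2))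
      ≤ δ / 2 * (w x * g ^ 2) ^ 2 + 2 / δ * ((q + 4) * a * pderiv1 i v x * g) ^ 2 := by
    have : δ / 2 * (w x * g ^ 2) ^ 2 + 2 / δ * ((q + 4) * a * pderiv1 i v x * g) ^ 2
        + 2 * ((q + 4) * a * pderiv1 i v x * g) * (w x * g ^ 2)
        = 1 / (2 * δ) * (δ * (w x * g ^ 2) + 2 * ((q + 4) * a * pderiv1 i v x * g)) ^ 2 := by
      field_simp
      ring
    have h3 : 0 ≤ 1 / (2 * δ) *
      (δ * (w x * g ^ 2) + 2 * ((q + 4) * a * pderiv1 i v x * g)) ^ 2 := by positivity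
    linarith
  have y2 : -(((q + 4) * b * g + (q + 4) * (q + 3) * a ^ 2) * v x * (w x * g ^ 2))
      ≤ δ / 2 * (w x * g ^ 2) ^ 2
        + 1 / (2 * δ) * (((q + 4) * b * g + (q + 4) * (q + 3) * a ^ 2) * v x) ^ 2 := by
    generalize (q + 4) * b * g + (q + 4) * (q + 3) * a ^ 2 = M
    have : δ / 2 * (w x * g ^ 2) ^ 2 + 1 / (2 * δ) * (M * v x) ^ 2 + M * v x * (w x * g ^ 2)
        = 1 / (2 * δ) * (δ * (w x * g ^ 2) + M * v x) ^ 2 := by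
      field_simp
      ring
    have h3 : 0 ≤ 1 / (2 * δ) * (δ * (w x * g ^ 2) + M * v x) ^ 2 := by positivity
    linarith
  have z1 : 2 / δ * ((q + 4) * a * pderiv1 i v x * g) ^ 2
      ≤ 2 * (q + 4) ^ 2 * (c * r) ^ 2 / δ * (pderiv1 i v x ^ 2 * g ^ 2) := by
    have := mul_le_mul_of_nonneg_left hb2
      (by positivity : 0 ≤ 2 / δ * ((q + 4) * pderiv1 i v x * g) ^ 2)
    calc _ = 2 / δ * ((q + 4) * pderiv1 i v x * g) ^ 2 * a ^ 2 := by ring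
      _ ≤ _ := this
      _ = _ := by ring
  have z2 : 1 / (2 * δ) * (((q + 4) * b * g + (q + 4) * (q + 3) * a ^ 2) * v x) ^ 2
      ≤ ((q + 4) * c + (q + 4) * (q + 3) * c ^ 2) ^ 2 * r ^ 4 / (2 * δ) * v x ^ 2 := by
    have := mul_le_mul_of_nonneg_left hN2 (by positivity : 0 ≤ 1 / (2 * δ) * v x ^ 2)
    calc _ = 1 / (2 * δ) * v x ^ 2 * ((q + 4) * b * g + (q + 4) * (q + 3) * a ^ 2) ^ 2 := by ring
      _ ≤ _ := this
      _ = _ := by ring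
  linarith

/-- Coercivity of `∫ v Δ²v γ^(q+4)`, up to a lower order term. -/
lemma exists_weightedIntegral_Lap_sq_le (n : ℕ) {c q : ℝ} (hc : 0 < c) (hq : 0 < q) :
    ∃ C : ℝ, 0 < C ∧ ∀ (γ : EuclideanSpace ℝ (Fin n) → ℝ) (ρ : ℝ), 0 < ρ → IsCutoff γ ρ c →
      ∀ v : EuclideanSpace ℝ (Fin n) → ℝ, ContDiff ℝ (⊤ : ℕ∞) v →
        3 / 4 * weightedIntegral γ (q + 4) (fun x => Lap v x ^ 2)
          ≤ weightedIntegral γ (q + 4) (fun x => v x * Lap (Lap v) x)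
            + C * ρ⁻¹ ^ 4 * weightedIntegral γ q (fun x => v x ^ 2) := by
  obtain ⟨δ, hδ⟩ : ∃ δ : ℝ, δ = 1 / (8 * (n + 1)) := ⟨_, rfl⟩
  have hδ0 : 0 < δ := by rw [hδ]; positivity
  refine ⟨2 * (q + 4) ^ 2 * c ^ 2 / δ *
      (16 * (q + 4) ^ 2 * c ^ 2 / δ + n * ((q + 2) ^ 2 * c ^ 2))
    + n * ((q + 4) * c + (q + 4) * (q + 3) * c ^ 2) ^ 2 / (2 * δ), by positivity, ?_⟩
  intro γ ρ hρ hγ v hv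
  have hL := contDiff_Lap hv
  have c0 := hv.continuous
  have cL := hL.continuous
  have cLL := (contDiff_Lap hL).continuous
  have cg := hγ.smooth.continuous
  have c2 (i) := (contDiff_pderiv1 (contDiff_pderiv1 hv i) i).continuous
  have cL2 (i) := (contDiff_pderiv1 (contDiff_pderiv1 hL i) i).continuous
  have h := Finset.sum_le_sum fun i (_ : i ∈ Finset.univ) =>
    weightedIntegral_green_coordinate_le hγ hq hv hL hδ0 i
  rw [← weightedIntegral_sum hγ hq (fun i => by fun_prop), Finset.sum_add_distrib,
    Finset.sum_add_distrib, ← Finset.mul_sum, ← Finset.mul_sum, Finset.sum_const, Finset.sum_const,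
    Finset.card_univ, Fintype.card_fin, nsmul_eq_mul, nsmul_eq_mul] at h
  have e : (fun x => ∑ i, (Lap v x * pderiv1 i (pderiv1 i v) x
      - v x * pderiv1 i (pderiv1 i (Lap v)) x) * γ x ^ 4)
      = fun x => Lap v x ^ 2 * γ x ^ 4 - v x * Lap (Lap v) x * γ x ^ 4 := by
    funext x
    rw [← Finset.sum_mul, Finset.sum_sub_distrib, ← Finset.mul_sum, ← Finset.mul_sum,
      ← congrFun (Lap_eq_sum_pderiv1 hv) x, ← congrFun (Lap_eq_sum_pderiv1 hL) x]
    ring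
  rw [e, weightedIntegral_sub hγ hq (by fun_prop) (by fun_prop)] at h
  have hl : 0 < δ / (16 * (q + 4) ^ 2 * (c * ρ⁻¹) ^ 2) := by positivity
  have hS := mul_le_mul_of_nonneg_left (weightedIntegral_gradient_sq_le hγ hq hv hl)
    (by positivity : 0 ≤ 2 * (q + 4) ^ 2 * (c * ρ⁻¹) ^ 2 / δ)
  have h4 := weightedIntegral_add_natCast hγ hq 4 (fun x => Lap v x ^ 2)
  have h5 := weightedIntegral_add_natCast hγ hq 4 (fun x => v x * Lap (Lap v) x)
  rw [Nat.cast_ofNat] at h4 h5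
  rw [h4, h5]
  have hA : 0 ≤ weightedIntegral γ q (fun x => Lap v x ^ 2 * γ x ^ 4) :=
    weightedIntegral_nonneg hγ q fun x => by positivity
  have hr : 0 < ρ⁻¹ := inv_pos.2 hρ
  generalize ρ⁻¹ = r at *
  generalize weightedIntegral γ q (fun x => Lap v x ^ 2 * γ x ^ 4) = A at *
  generalize weightedIntegral γ q (fun x => v x * Lap (Lap v) x * γ x ^ 4) = P at *
  generalize weightedIntegral γ q (fun x => v x ^ 2) = B at *
  generalize ∑ i, weightedIntegral γ q (fun x => pderiv1 i v x ^ 2 * γ x ^ 2) = S at *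
  have hS' : 2 * (q + 4) ^ 2 * (c * r) ^ 2 / δ * S ≤ 1 / 8 * A
      + 2 * (q + 4) ^ 2 * c ^ 2 / δ *
        (16 * (q + 4) ^ 2 * c ^ 2 / δ + n * ((q + 2) ^ 2 * c ^ 2)) * r ^ 4 * B := by
    refine hS.trans (le_of_eq ?_)
    field_simp
    ring
  have hn : n * (δ * A) ≤ 1 / 8 * A := by
    rw [← mul_assoc]
    refine mul_le_mul_of_nonneg_right ?_ hA
    rw [hδ, mul_one_div, div_le_div_iff₀ (by positivity) (by norm_num)]
    linarith
  have hB : (n : ℝ) * (((q + 4) * c + (q + 4) * (q + 3) * c ^ 2) ^ 2 * r ^ 4 / (2 * δ) * B)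
      = n * ((q + 4) * c + (q + 4) * (q + 3) * c ^ 2) ^ 2 / (2 * δ) * r ^ 4 * B := by ring
  rw [hB] at h
  linarith

lemma exists_weightedIntegral_iterLap_interpolation (n : ℕ) {c q : ℝ} (hc : 0 < c) (hq : 0 < q)
    (m : ℕ) : ∀ ε : ℝ, 0 < ε →
    ∃ C : ℝ, 0 < C ∧ ∀ (γ : EuclideanSpace ℝ (Fin n) → ℝ) (ρ : ℝ), 0 < ρ → IsCutoff γ ρ c →
      ∀ v : EuclideanSpace ℝ (Fin n) → ℝ, ContDiff ℝ (⊤ : ℕ∞) v →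
        weightedIntegral γ (q + 4 * m) (fun x => iterLap m v x ^ 2)
          ≤ ε * ρ ^ 4 * weightedIntegral γ (q + 4 * m + 4) (fun x => iterLap (m + 1) v x ^ 2)
            + C * ρ⁻¹ ^ (4 * m) * weightedIntegral γ q (fun x => v x ^ 2) := by
  induction m with
  | zero =>
    refine fun ε hε => ⟨1, one_pos, fun γ ρ hρ hγ v _ => ?_⟩
    have hA : 0 ≤ weightedIntegral γ (q + 4 * (0 : ℕ) + 4) (fun x => iterLap (0 + 1) v x ^ 2) :=
      weightedIntegral_nonneg hγ _ fun x => sq_nonneg _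
    have : 0 ≤ ε * ρ ^ 4 *
      weightedIntegral γ (q + 4 * (0 : ℕ) + 4) (fun x => iterLap (0 + 1) v x ^ 2) := by positivity
    simpa [iterLap] using this
  | succ m ih =>
    intro ε hε
    have hqm : 0 < q + 4 * m := by positivity
    obtain ⟨C₁, hC₁, H₁⟩ := exists_weightedIntegral_Lap_sq_le n hc hqm
    obtain ⟨C, hC, H⟩ := ih (1 / (4 * (C₁ + 1 / (2 * ε)))) (by positivity)
    refine ⟨2 * (C₁ + 1 / (2 * ε)) * C, by positivity, fun γ ρ hρ hγ v hv => ?_⟩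
    have hw := contDiff_iterLap hv m
    have h₁ := H₁ γ ρ hρ hγ _ hw
    have h₂ := H γ ρ hρ hγ v hv
    have s1 : Lap (iterLap m v) = iterLap (m + 1) v :=
      (Function.iterate_succ_apply' Lap m v).symm
    have s2 : Lap (iterLap (m + 1) v) = iterLap (m + 2) v :=
      (Function.iterate_succ_apply' Lap (m + 1) v).symm
    rw [s1, s2] at h₁
    have ec : q + 4 * ((m + 1 : ℕ) : ℝ) = q + 4 * m + 4 := by push_cast; ring
    rw [ec]
    have c0 := hw.continuous
    have c2 := (contDiff_iterLap hv (m + 2)).continuous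
    have cg := hγ.smooth.continuous
    have h₃ := weightedIntegral_le_of_le hγ hqm
      (F := fun x => iterLap m v x * iterLap (m + 2) v x * γ x ^ 4) (D := fun _ => 0)
      (G := fun x => iterLap (m + 2) v x ^ 2 * γ x ^ 8)
      (H := fun x => iterLap m v x ^ 2) (K := fun _ => 0)
      (by fun_prop) (by fun_prop) (by fun_prop) (by fun_prop) (by fun_prop)
      (by simp [weightedIntegral]) 0 (ε / 2 * ρ ^ 4) (1 / (2 * ε) * ρ⁻¹ ^ 4) 0 ?_
    · have h4 := weightedIntegral_add_natCast hγ hqm 8 (fun x => iterLap (m + 2) v x ^ 2)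
      have h5 := weightedIntegral_add_natCast hγ hqm 4
        (fun x => iterLap m v x * iterLap (m + 2) v x)
      rw [Nat.cast_ofNat] at h4 h5
      rw [← h4, ← h5] at h₃
      rw [add_assoc (q + 4 * (m : ℝ)) 4 4, show (4 : ℝ) + 4 = 8 by norm_num]
      have h₄ := mul_le_mul_of_nonneg_left h₂
        (by positivity : 0 ≤ (C₁ + 1 / (2 * ε)) * ρ⁻¹ ^ 4)
      have ep : ρ⁻¹ ^ (4 * (m + 1)) = ρ⁻¹ ^ 4 * ρ⁻¹ ^ (4 * m) := by ring
      rw [ep]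
      have e6 : (C₁ + 1 / (2 * ε)) * ρ⁻¹ ^ 4 * (1 / (4 * (C₁ + 1 / (2 * ε))) * ρ ^ 4 *
          weightedIntegral γ (q + 4 * m + 4) (fun x => iterLap (m + 1) v x ^ 2))
          = 1 / 4 * weightedIntegral γ (q + 4 * m + 4) (fun x => iterLap (m + 1) v x ^ 2) := by
        field_simp
      rw [mul_add, e6] at h₄
      linarith
    · intro x
      have : ε / 2 * ρ ^ 4 * (iterLap (m + 2) v x ^ 2 * γ x ^ 8)
          + 1 / (2 * ε) * ρ⁻¹ ^ 4 * iterLap m v x ^ 2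
          - iterLap m v x * iterLap (m + 2) v x * γ x ^ 4
          = 1 / (2 * ε) *
            (ε * ρ ^ 2 * (iterLap (m + 2) v x * γ x ^ 4) - ρ⁻¹ ^ 2 * iterLap m v x) ^ 2 := by
        field_simp
        ring
      have h3 : 0 ≤ 1 / (2 * ε) *
        (ε * ρ ^ 2 * (iterLap (m + 2) v x * γ x ^ 4) - ρ⁻¹ ^ 2 * iterLap m v x) ^ 2 := by
          positivity
      linarith

end Interpolation

section SpaceTime

variable {n : ℕ} {T : ℝ} {w z : EuclideanSpace ℝ (Fin n) × ℝ → ℝ}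

/-- The closed space-time slab `ℝⁿ × [0, T]`. -/
def slab (n : ℕ) (T : ℝ) : Set (EuclideanSpace ℝ (Fin n) × ℝ) := Set.univ ×ˢ Set.Icc 0 T

lemma uniqueDiffOn_slab (n : ℕ) (hT : 0 < T) : UniqueDiffOn ℝ (slab n T) :=
  uniqueDiffOn_univ.prod (uniqueDiffOn_Icc hT)

lemma slab_subset_closure_interior (n : ℕ) (hT : 0 < T) :
    slab n T ⊆ closure (interior (slab n T)) := by
  rw [slab, interior_prod_eq, closure_prod_eq, interior_univ, closure_univ, interior_Icc,
    closure_Ioo hT.ne]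

/-- One-sided directional derivative on the slab `ℝⁿ × [0, T]`. -/
def slabDeriv (T : ℝ) (v : EuclideanSpace ℝ (Fin n) × ℝ) (w : EuclideanSpace ℝ (Fin n) × ℝ → ℝ) :
    EuclideanSpace ℝ (Fin n) × ℝ → ℝ :=
  fun p => fderivWithin ℝ w (slab n T) p v

/-- The spatial Laplacian on the slab `ℝⁿ × [0, T]`. -/
def slabLap (T : ℝ) (w : EuclideanSpace ℝ (Fin n) × ℝ → ℝ) : EuclideanSpace ℝ (Fin n) × ℝ → ℝ :=
  fun p => ∑ i : Fin n, slabDeriv T (EuclideanSpace.single i (1 : ℝ), 0)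
    (slabDeriv T (EuclideanSpace.single i (1 : ℝ), 0) w) p

lemma contDiffOn_slabDeriv (hT : 0 < T) (hw : ContDiffOn ℝ (⊤ : ℕ∞) w (slab n T))
    (v : EuclideanSpace ℝ (Fin n) × ℝ) : ContDiffOn ℝ (⊤ : ℕ∞) (slabDeriv T v w) (slab n T) :=
  (hw.fderivWithin (m := (⊤ : ℕ∞)) (uniqueDiffOn_slab n hT) (by simp)).clm_apply contDiffOn_const

lemma contDiffOn_slabLap (hT : 0 < T) (hw : ContDiffOn ℝ (⊤ : ℕ∞) w (slab n T)) :
    ContDiffOn ℝ (⊤ : ℕ∞) (slabLap T w) (slab n T) :=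
  ContDiffOn.sum fun _ _ => contDiffOn_slabDeriv hT (contDiffOn_slabDeriv hT hw _) _

lemma contDiffOn_iterate_slabLap (hT : 0 < T) (hw : ContDiffOn ℝ (⊤ : ℕ∞) w (slab n T)) (k : ℕ) :
    ContDiffOn ℝ (⊤ : ℕ∞) ((slabLap T)^[k] w) (slab n T) := by
  induction k with
  | zero => exact hw
  | succ k ih => rw [Function.iterate_succ_apply']; exact contDiffOn_slabLap hT ih

lemma eqOn_slabDeriv (h : EqOn w z (slab n T)) (v : EuclideanSpace ℝ (Fin n) × ℝ) :
    EqOn (slabDeriv T v w) (slabDeriv T v z) (slab n T) := fun p hp => by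
  rw [slabDeriv, slabDeriv, fderivWithin_congr h (h hp)]

lemma eqOn_slabLap (h : EqOn w z (slab n T)) :
    EqOn (slabLap T w) (slabLap T z) (slab n T) := fun _ hp =>
  Finset.sum_congr rfl fun _ _ => eqOn_slabDeriv (eqOn_slabDeriv h _) _ hp

lemma slabDeriv_neg (hT : 0 < T) (v : EuclideanSpace ℝ (Fin n) × ℝ) :
    EqOn (slabDeriv T v (-w)) (-slabDeriv T v w) (slab n T) := fun p hp => by
  rw [slabDeriv, fderivWithin_neg (uniqueDiffOn_slab n hT p hp)]
  rfl

lemma slabLap_neg (hT : 0 < T) : EqOn (slabLap T (-w)) (-slabLap T w) (slab n T) := fun p hp => by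
  rw [Pi.neg_apply, slabLap, slabLap, ← Finset.sum_neg_distrib]
  exact Finset.sum_congr rfl fun i _ =>
    (eqOn_slabDeriv (slabDeriv_neg hT _) _ hp).trans (slabDeriv_neg hT _ hp)

lemma slabDeriv_comm (hT : 0 < T) (hw : ContDiffOn ℝ (⊤ : ℕ∞) w (slab n T))
    (a b : EuclideanSpace ℝ (Fin n) × ℝ) :
    EqOn (slabDeriv T a (slabDeriv T b w)) (slabDeriv T b (slabDeriv T a w)) (slab n T) := by
  intro p hp
  have hu := uniqueDiffOn_slab n hT
  have hd : DifferentiableWithinAt ℝ (fderivWithin ℝ w (slab n T)) (slab n T) p :=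
    (hw.fderivWithin (m := (⊤ : ℕ∞)) hu (by simp)).differentiableOn (by simp) p hp
  have e (c : EuclideanSpace ℝ (Fin n) × ℝ) : fderivWithin ℝ (slabDeriv T c w) (slab n T) p
      = (fderivWithin ℝ (fderivWithin ℝ w (slab n T)) (slab n T) p).flip c := by
    change fderivWithin ℝ (fun q => fderivWithin ℝ w (slab n T) q c) (slab n T) p = _
    rw [fderivWithin_clm_apply (hu p hp) hd (differentiableWithinAt_const _)]
    simp
  have hs : IsSymmSndFDerivWithinAt ℝ w (slab n T) p :=
    (hw p hp).isSymmSndFDerivWithinAt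
      (by
          rw [minSmoothness_of_isRCLikeNormedField]
          exact WithTop.coe_le_coe.2 (le_top : (2 : ℕ∞) ≤ ⊤)) hu
      (slab_subset_closure_interior n hT hp) hp
  change fderivWithin ℝ (slabDeriv T b w) (slab n T) p a
    = fderivWithin ℝ (slabDeriv T a w) (slab n T) p b
  rw [e, e]
  exact hs.eq a b

lemma slabDeriv_slabLap (hT : 0 < T) (hw : ContDiffOn ℝ (⊤ : ℕ∞) w (slab n T))
    (a : EuclideanSpace ℝ (Fin n) × ℝ) :
    EqOn (slabDeriv T a (slabLap T w)) (slabLap T (slabDeriv T a w)) (slab n T) := by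
  intro p hp
  have hu := uniqueDiffOn_slab n hT
  have h : slabDeriv T a (slabLap T w) p = ∑ i : Fin n,
      slabDeriv T a (slabDeriv T (EuclideanSpace.single i (1 : ℝ), 0)
        (slabDeriv T (EuclideanSpace.single i (1 : ℝ), 0) w)) p := by
    rw [slabDeriv]
    change fderivWithin ℝ (fun p => ∑ i : Fin n, slabDeriv T (EuclideanSpace.single i (1 : ℝ), 0)
      (slabDeriv T (EuclideanSpace.single i (1 : ℝ), 0) w) p) (slab n T) p a = _
    rw [fderivWithin_fun_sum (hu p hp) fun i _ => ((contDiffOn_slabDeriv hT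
      (contDiffOn_slabDeriv hT hw _) _).differentiableOn (by simp) p hp)]
    simp [slabDeriv]
  rw [h]
  refine Finset.sum_congr rfl fun i _ => ?_
  rw [slabDeriv_comm hT (contDiffOn_slabDeriv hT hw _) a _ hp]
  exact eqOn_slabDeriv (slabDeriv_comm hT hw a _) _ hp

lemma contDiff_slice (hw : ContDiffOn ℝ (⊤ : ℕ∞) w (slab n T)) {t : ℝ} (ht : t ∈ Icc 0 T) :
    ContDiff ℝ (⊤ : ℕ∞) fun y => w (y, t) := by
  rw [← contDiffOn_univ]
  exact hw.comp (contDiff_id.prodMk contDiff_const).contDiffOn fun x _ => ⟨mem_univ x, ht⟩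

lemma pderiv1_slice (hw : ContDiffOn ℝ (⊤ : ℕ∞) w (slab n T)) {t : ℝ} (ht : t ∈ Icc 0 T)
    (i : Fin n) :
    pderiv1 i (fun y => w (y, t))
      = fun x => slabDeriv T (EuclideanSpace.single i (1 : ℝ), 0) w (x, t) := by
  funext x
  have h1 := (hw.differentiableOn (by simp) (x, t) ⟨mem_univ x, ht⟩).hasFDerivWithinAt
  have h2 := h1.comp x ((hasFDerivAt_prodMk_left (𝕜 := ℝ) x t).hasFDerivWithinAt (s := univ))
    (show MapsTo (fun y => (y, t)) univ (slab n T) from fun y _ => ⟨mem_univ y, ht⟩)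
  have h3 : HasFDerivAt (fun y => w (y, t)) _ x := h2.hasFDerivAt Filter.univ_mem
  rw [pderiv1, h3.fderiv]
  simp [slabDeriv]

lemma hasDerivWithinAt_slice (hw : ContDiffOn ℝ (⊤ : ℕ∞) w (slab n T)) {t : ℝ} (ht : t ∈ Icc 0 T)
    (x : EuclideanSpace ℝ (Fin n)) :
    HasDerivWithinAt (fun τ => w (x, τ)) (slabDeriv T (0, 1) w (x, t)) (Icc 0 T) t := by
  have h1 := (hw.differentiableOn (by simp) (x, t) ⟨mem_univ x, ht⟩).hasFDerivWithinAt
  have h2 := h1.comp t ((hasFDerivAt_prodMk_right (𝕜 := ℝ) x t).hasFDerivWithinAt (s := Icc 0 T))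
    fun τ hτ => ⟨mem_univ x, hτ⟩
  have h3 := h2.hasDerivWithinAt
  simpa [slabDeriv, Function.comp_def] using h3

lemma Lap_slice (hT : 0 < T) (hw : ContDiffOn ℝ (⊤ : ℕ∞) w (slab n T)) {t : ℝ} (ht : t ∈ Icc 0 T) :
    Lap (fun y => w (y, t)) = fun x => slabLap T w (x, t) := by
  rw [Lap_eq_sum_pderiv1 (contDiff_slice hw ht)]
  funext x
  refine Finset.sum_congr rfl fun i _ => ?_
  rw [pderiv1_slice hw ht, pderiv1_slice (contDiffOn_slabDeriv hT hw _) ht]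

lemma iterLap_slice (hT : 0 < T) (hw : ContDiffOn ℝ (⊤ : ℕ∞) w (slab n T)) {t : ℝ}
    (ht : t ∈ Icc 0 T) (k : ℕ) :
    iterLap k (fun y => w (y, t)) = fun x => (slabLap T)^[k] w (x, t) := by
  induction k with
  | zero => rfl
  | succ k ih =>
    rw [iterLap, Function.iterate_succ_apply', ← iterLap, ih,
      Lap_slice hT (contDiffOn_iterate_slabLap hT hw k) ht, Function.iterate_succ_apply']

lemma hasDerivWithinAt_iterate_slabLap (hT : 0 < T) (hw : ContDiffOn ℝ (⊤ : ℕ∞) w (slab n T))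
    (heq : ∀ x, ∀ t ∈ Icc (0 : ℝ) T,
      HasDerivWithinAt (fun τ => w (x, τ)) (-(iterLap 2 (fun y => w (y, t)) x)) (Icc 0 T) t)
    (k : ℕ) (x : EuclideanSpace ℝ (Fin n)) {t : ℝ} (ht : t ∈ Icc 0 T) :
    HasDerivWithinAt (fun τ => (slabLap T)^[k] w (x, τ)) (-(slabLap T)^[k + 2] w (x, t))
      (Icc 0 T) t := by
  have key : EqOn (slabDeriv T (0, 1) ((slabLap T)^[k] w)) (-(slabLap T)^[k + 2] w)
      (slab n T) := by
    induction k with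
    | zero =>
      rintro ⟨y, τ⟩ ⟨-, hτ⟩
      have h := (uniqueDiffOn_Icc hT τ hτ).eq_deriv _ (hasDerivWithinAt_slice hw hτ y)
        (heq y τ hτ)
      rw [iterLap_slice hT hw hτ] at h
      exact h
    | succ k ih =>
      have e : (slabLap T)^[k + 1 + 2] w = slabLap T ((slabLap T)^[k + 2] w) :=
        Function.iterate_succ_apply' _ _ _
      rw [Function.iterate_succ_apply', e]
      exact ((slabDeriv_slabLap hT (contDiffOn_iterate_slabLap hT hw k) _).trans
        (eqOn_slabLap ih)).trans (slabLap_neg hT)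
  have h := hasDerivWithinAt_slice (contDiffOn_iterate_slabLap hT hw k) ht x
  rwa [key ⟨mem_univ x, ht⟩] at h

/-- Differentiation of a weighted integral under the integral sign, up to the end points. -/
lemma hasDerivWithinAt_weightedIntegral {γ : EuclideanSpace ℝ (Fin n) → ℝ} {ρ c q : ℝ}
    (hγ : IsCutoff γ ρ c) (hq : 0 < q) (hw : ContinuousOn w (slab n T))
    (hz : ContinuousOn z (slab n T))
    (hwz : ∀ x, ∀ t ∈ Icc (0 : ℝ) T, HasDerivWithinAt (fun τ => w (x, τ)) (z (x, t)) (Icc 0 T) t)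
    {t : ℝ} (ht : t ∈ Icc 0 T) :
    HasDerivWithinAt (fun τ => weightedIntegral γ q fun x => w (x, τ))
      (weightedIntegral γ q fun x => z (x, t)) (Icc 0 T) t := by
  have slice {f : EuclideanSpace ℝ (Fin n) × ℝ → ℝ} (hf : ContinuousOn f (slab n T)) {τ : ℝ}
      (hτ : τ ∈ Icc 0 T) : Continuous fun x => f (x, τ) :=
    hf.comp_continuous (by fun_prop) fun x => ⟨mem_univ x, hτ⟩
  obtain ⟨C, hC⟩ := ((isCompact_closedBall (0 : EuclideanSpace ℝ (Fin n)) (2 * ρ)).prod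
    (isCompact_Icc (a := (0 : ℝ)) (b := T))).exists_bound_of_continuousOn
    (hz.mono (prod_mono (subset_univ _) subset_rfl))
  rw [hasDerivWithinAt_iff_tendsto_slope]
  have hmem : ∀ᶠ τ in nhdsWithin t (Icc 0 T \ {t}), τ ∈ Icc 0 T \ {t} := self_mem_nhdsWithin
  have hslope : ∀ τ ∈ Icc 0 T \ {t},
      ∫ x, (slope (fun σ => w (x, σ)) t τ) * γ x ^ q
        = slope (fun σ => weightedIntegral γ q fun x => w (x, σ)) t τ := by
    intro τ hτ
    rw [slope_def_field, weightedIntegral, weightedIntegral,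
      ← integral_sub (hγ.integrable_mul_rpow hq (slice hw hτ.1))
        (hγ.integrable_mul_rpow hq (slice hw ht)), ← integral_div]
    refine integral_congr_ae (Filter.Eventually.of_forall fun x => ?_)
    simp only [slope_def_field]
    ring
  refine Filter.Tendsto.congr' (hmem.mono hslope) ?_
  refine tendsto_integral_filter_of_dominated_convergence (fun x => C * γ x ^ q) ?_ ?_
    (hγ.integrable_mul_rpow hq continuous_const) (Filter.Eventually.of_forall fun x => ?_)
  · refine hmem.mono fun τ hτ => ?_
    simp only [slope_def_field]
    exact ((((slice hw hτ.1).sub (slice hw ht)).div_const _).mul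
      (hγ.continuous_rpow hq)).aestronglyMeasurable
  · refine hmem.mono fun τ hτ => Filter.Eventually.of_forall fun x => ?_
    rw [norm_mul, Real.norm_of_nonneg (Real.rpow_nonneg (hγ.nonneg x) q)]
    by_cases hx : x ∈ ball (0 : EuclideanSpace ℝ (Fin n)) (2 * ρ)
    · refine mul_le_mul_of_nonneg_right ?_ (Real.rpow_nonneg (hγ.nonneg x) q)
      have h := (convex_Icc (0 : ℝ) T).norm_image_sub_le_of_norm_hasDerivWithin_le
        (fun σ hσ => hwz x σ hσ) (fun σ hσ => hC (x, σ) ⟨ball_subset_closedBall hx, hσ⟩) ht hτ.1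
      rw [slope_def_field, norm_div]
      exact div_le_of_le_mul₀ (norm_nonneg _) ((norm_nonneg _).trans
        (hC (x, t) ⟨ball_subset_closedBall hx, ht⟩)) h
    · rw [hγ.eq_zero hx, Real.zero_rpow hq.ne', mul_zero, mul_zero]
  · exact (hasDerivWithinAt_iff_tendsto_slope.1 (hwz x t ht)).mul_const _

end SpaceTime

lemma exists_energy_evolution_bound (n : ℕ) (s : ℝ) {c : ℝ} (hc : 0 < c) {k : ℕ} (hk : 1 ≤ k)
    (hs : 4 * (k : ℝ) < s) :
    ∃ C : ℝ, 0 ≤ C ∧ ∀ T : ℝ, 0 < T → ∀ w : EuclideanSpace ℝ (Fin n) × ℝ → ℝ,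
      ContDiffOn ℝ (⊤ : ℕ∞) w (slab n T) →
      (∀ x, ∀ t ∈ Icc (0 : ℝ) T,
        HasDerivWithinAt (fun τ => w (x, τ)) (-(iterLap 2 (fun y => w (y, t)) x)) (Icc 0 T) t) →
      ∀ (γ : EuclideanSpace ℝ (Fin n) → ℝ) (ρ : ℝ), 0 < ρ → IsCutoff γ ρ c →
      ∀ t ∈ Icc (0 : ℝ) T, ∃ d : ℝ,
        HasDerivWithinAt
          (fun τ => weightedIntegral γ s fun x => iterLap k (fun y => w (y, τ)) x ^ 2)
          d (Icc 0 T) t ∧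
        d + weightedIntegral γ s (fun x => iterLap (k + 1) (fun y => w (y, t)) x ^ 2)
          ≤ C / ρ ^ (4 * k)
            * weightedIntegral γ (s - 4 * k) (fun x => Lap (fun y => w (y, t)) x ^ 2) := by
  obtain ⟨m, rfl⟩ : ∃ m, k = m + 1 := ⟨k - 1, by omega⟩
  have hq0 : 0 < s - 4 * ((m + 1 : ℕ) : ℝ) := by linarith
  obtain ⟨q, hq⟩ : ∃ q, q = s - 4 * ((m + 1 : ℕ) : ℝ) := ⟨_, rfl⟩
  rw [← hq] at hq0 ⊢
  have hs' : s = q + 4 * m + 4 := by rw [hq]; push_cast; ring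
  have hqm : 0 < q + 4 * m := by positivity
  obtain ⟨C₁, hC₁, H₁⟩ := exists_weightedIntegral_Lap_sq_le n hc hqm
  obtain ⟨C₂, hC₂, H₂⟩ := exists_weightedIntegral_iterLap_interpolation n hc hq0 m
    (1 / (4 * C₁)) (by positivity)
  refine ⟨2 * C₁ * C₂, by positivity, fun T hT w hw heq γ ρ hρ hγ t ht => ?_⟩
  set W := fun j => (slabLap T)^[j] w with hWdef
  have hW (j) : ContDiffOn ℝ (⊤ : ℕ∞) (W j) (slab n T) := contDiffOn_iterate_slabLap hT hw j
  have hslice {τ : ℝ} (hτ : τ ∈ Icc 0 T) (j : ℕ) :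
      iterLap j (fun y => w (y, τ)) = fun x => W j (x, τ) := iterLap_slice hT hw hτ j
  have hd := hasDerivWithinAt_weightedIntegral hγ (hqm.trans (by linarith : q + 4 * m < s))
    (w := fun p => W (m + 1) p ^ 2) (z := fun p => -2 * (W (m + 1) p * W (m + 3) p))
    ((hW (m + 1)).continuousOn.pow 2)
    (continuousOn_const.mul ((hW (m + 1)).continuousOn.mul (hW (m + 3)).continuousOn))
    (fun x τ hτ => by
      refine ((hasDerivWithinAt_iterate_slabLap hT hw heq (m + 1) x hτ).pow 2).congr_deriv ?_
      simp only [hWdef]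
      push_cast
      ring) ht
  refine ⟨_, hd.congr (fun τ hτ => by simp only [hslice hτ]) (by simp only [hslice ht]), ?_⟩
  have hLu : Lap (fun y => w (y, t)) = fun x => W 1 (x, t) := hslice ht 1
  have hj (j : ℕ) : iterLap j (fun x => W 1 (x, t)) = fun x => W (j + 1) (x, t) := by
    rw [← hLu, ← hslice ht (j + 1)]
    rfl
  have hLW (j : ℕ) : Lap (fun x => W j (x, t)) = fun x => W (j + 1) (x, t) := by
    rw [← hslice ht, ← hslice ht]
    exact (Function.iterate_succ_apply' Lap j _).symm
  have h₁ := H₁ γ ρ hρ hγ (fun x => W (m + 1) (x, t)) (contDiff_slice (hW _) ht)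
  have h₂ := H₂ γ ρ hρ hγ (fun x => W 1 (x, t)) (contDiff_slice (hW _) ht)
  simp only [hLW] at h₁
  simp only [hj] at h₂
  rw [weightedIntegral_const_mul, hLu]
  simp only [hslice ht]
  rw [← hs'] at h₁ h₂
  have hA : 0 ≤ weightedIntegral γ s fun x => W (m + 1 + 1) (x, t) ^ 2 :=
    weightedIntegral_nonneg hγ s fun x => sq_nonneg _
  have h₃ := mul_le_mul_of_nonneg_left h₂ (by positivity : 0 ≤ 2 * (C₁ * ρ⁻¹ ^ 4))
  have e1 (A : ℝ) : 2 * (C₁ * ρ⁻¹ ^ 4) * (1 / (4 * C₁) * ρ ^ 4 * A) = 1 / 2 * A := by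
    field_simp
    norm_num
  have e2 (B : ℝ) : 2 * (C₁ * ρ⁻¹ ^ 4) * (C₂ * ρ⁻¹ ^ (4 * m) * B)
      = 2 * C₁ * C₂ / ρ ^ (4 * (m + 1)) * B := by
    rw [div_eq_mul_inv, ← inv_pow, mul_add, pow_add]
    ring
  rw [mul_add, e1, e2] at h₃
  linarith

/-- **Corollary 3.5.** For a smooth solution of `∂ₜu = -Δ²u`, `k ≥ 1`, `η = γˢ` with
`s > 4k` and `γ` a cutoff as in `(γ)`, there is a constant `c₄ = c₄(n,s)` such that
`(d/dt)E^k_η(u) + E^{k+1}_η(u) ≤ (c₄/ρ^{4k})∫|Δu|²γ^{s-4k}` on `[0,T]`. -/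
theorem energy_evolution_estimate_low_order (n : ℕ) (s cγ : ℝ) (hcγ : 1 ≤ cγ) :
    ∃ c₄ : ℝ, ∀ (T : ℝ), 0 < T →
      ∀ u : EuclideanSpace ℝ (Fin n) → ℝ → ℝ,
      ContDiffOn ℝ (⊤ : ℕ∞) (fun p : EuclideanSpace ℝ (Fin n) × ℝ => u p.1 p.2)
        (Set.univ ×ˢ Set.Icc 0 T) →
      (∀ x : EuclideanSpace ℝ (Fin n), ∀ t ∈ Set.Icc (0 : ℝ) T,
        HasDerivWithinAt (fun τ => u x τ) (-(iterLap 2 (fun y => u y t) x))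
          (Set.Icc 0 T) t) →
      ∀ (γ : EuclideanSpace ℝ (Fin n) → ℝ) (ρ : ℝ), 0 < ρ → IsCutoff γ ρ cγ →
      ∀ k : ℕ, 1 ≤ k → 4 * (k : ℝ) < s → ∀ t ∈ Set.Icc (0 : ℝ) T,
      ∃ d : ℝ,
        HasDerivWithinAt
          (fun τ => ∫ x, (iterLap k (fun y => u y τ) x) ^ 2 * γ x ^ s) d (Set.Icc 0 T) t ∧
        d + (∫ x, (iterLap (k + 1) (fun y => u y t) x) ^ 2 * γ x ^ s)
          ≤ c₄ / ρ ^ (4 * k)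
            * (∫ x, (Lap (fun y => u y t) x) ^ 2 * γ x ^ (s - 4 * (k : ℝ))) := by
  have H (k : ℕ) : ∃ C : ℝ, 0 ≤ C ∧ (1 ≤ k ∧ 4 * (k : ℝ) < s → ∀ T : ℝ, 0 < T →
      ∀ w : EuclideanSpace ℝ (Fin n) × ℝ → ℝ, ContDiffOn ℝ (⊤ : ℕ∞) w (slab n T) →
      (∀ x, ∀ t ∈ Icc (0 : ℝ) T,
        HasDerivWithinAt (fun τ => w (x, τ)) (-(iterLap 2 (fun y => w (y, t)) x)) (Icc 0 T) t) →
      ∀ (γ : EuclideanSpace ℝ (Fin n) → ℝ) (ρ : ℝ), 0 < ρ → IsCutoff γ ρ cγ →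
      ∀ t ∈ Icc (0 : ℝ) T, ∃ d : ℝ,
        HasDerivWithinAt
          (fun τ => weightedIntegral γ s fun x => iterLap k (fun y => w (y, τ)) x ^ 2)
          d (Icc 0 T) t ∧
        d + weightedIntegral γ s (fun x => iterLap (k + 1) (fun y => w (y, t)) x ^ 2)
          ≤ C / ρ ^ (4 * k)
            * weightedIntegral γ (s - 4 * k) (fun x => Lap (fun y => w (y, t)) x ^ 2)) := by
    by_cases hk : 1 ≤ k ∧ 4 * (k : ℝ) < s
    · obtain ⟨C, hC0, hC⟩ :=
        exists_energy_evolution_bound n s (zero_lt_one.trans_le hcγ) hk.1 hk.2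
      exact ⟨C, hC0, fun _ => hC⟩
    · exact ⟨0, le_rfl, fun h => absurd h hk⟩
  choose C hC0 hC using H
  refine ⟨∑ k ∈ Finset.range ⌈s⌉₊, C k, fun T hT u hu heq γ ρ hρ hγ k hk hks t ht => ?_⟩
  obtain ⟨d, hd, hle⟩ := hC k ⟨hk, hks⟩ T hT (fun p => u p.1 p.2) hu heq γ ρ hρ hγ t ht
  refine ⟨d, hd, hle.trans ?_⟩
  have hmem : k ∈ Finset.range ⌈s⌉₊ := by
    have h : (k : ℝ) < ⌈s⌉₊ := by
      linarith [Nat.le_ceil s, (Nat.cast_nonneg k : (0 : ℝ) ≤ k)]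
    exact Finset.mem_range.2 (mod_cast h)
  exact mul_le_mul_of_nonneg_right (div_le_div_of_nonneg_right
    (Finset.single_le_sum (fun j _ => hC0 j) hmem) (by positivity))
    (weightedIntegral_nonneg hγ _ fun x => sq_nonneg _)
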